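/- Adding 3 ballots C₂≻C₁≻C₄≻C₃ to the 1000-voter profile (334:C₁≻C₃≻C₄≻C₂, 314:C₂≻C₁≻C₃≻C₄, 312:C₃≻C₂≻C₁≻C₄, 40:C₄≻C₁≻C₂≻C₃) changes the 2-seat STV winner set from {C₁,C₂} to {C₁,C₃}. With 1003 voters the quota rises to 335, so C₁ (334 votes) no longer reaches quota in round 1; instead C₄ (40 votes) is eliminated, transferring 40 votes to C₁ who is elected with 374 votes; C₁'s surplus of 39 transfers to C₃ (proportionally along the 334 C₁≻C₃ ballots, giving C₃ 39·(334/374) ≈ 34.8 extra); in the final round C₃ has more votes than C₂, so C₃ wins the second seat. This demonstrates paradoxes of positive involvement (the added ballots rank C₂ first, yet C₂ loses) and negative involvement (they rank C₃ last, yet C₃ wins). -/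

import Mathlib

section STV

variable {C : Type*} [DecidableEq C] [LinearOrder C]

/-- A weighted ballot: a ranking of candidates together with its current
(rational) weight. -/
abbrev WBallot (C : Type*) := List C × ℚ

/-- The highest-ranked candidate on a ballot who is still remaining (neither
elected nor eliminated). -/
def wtop (rem : Finset C) (b : WBallot C) : Option C := b.1.find? (· ∈ rem)

/-- The current vote total of candidate `c`: the total weight of the ballots
whose highest-ranked remaining candidate is `c`. -/
def wscore (ballots : List (WBallot C)) (rem : Finset C) (c : C) : ℚ :=
  ((ballots.filter (fun b => wtop rem b = some c)).map Prod.snd).sum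

/-- A remaining candidate with the largest current vote total (ties broken
deterministically by the linear order on `C`). -/
def argmaxScore (ballots : List (WBallot C)) (rem : Finset C) (h : rem.Nonempty) : C :=
  (rem.filter (fun c => ∀ d ∈ rem, wscore ballots rem d ≤ wscore ballots rem c)).min'
    (by
      obtain ⟨c, hc, hmax⟩ := rem.exists_max_image (wscore ballots rem) h
      exact ⟨c, Finset.mem_filter.mpr ⟨hc, hmax⟩⟩)

/-- A remaining candidate with the smallest current vote total (ties broken
deterministically by the linear order on `C`). -/
def argminScore (ballots : List (WBallot C)) (rem : Finset C) (h : rem.Nonempty) : C :=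
  (rem.filter (fun c => ∀ d ∈ rem, wscore ballots rem c ≤ wscore ballots rem d)).min'
    (by
      obtain ⟨c, hc, hmin⟩ := rem.exists_min_image (wscore ballots rem) h
      exact ⟨c, Finset.mem_filter.mpr ⟨hc, hmin⟩⟩)

theorem argmaxScore_mem (ballots : List (WBallot C)) (rem : Finset C) (h : rem.Nonempty) :
    argmaxScore ballots rem h ∈ rem :=
  Finset.filter_subset _ _ (Finset.min'_mem _ _)

theorem argminScore_mem (ballots : List (WBallot C)) (rem : Finset C) (h : rem.Nonempty) :
    argminScore ballots rem h ∈ rem :=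
  Finset.filter_subset _ _ (Finset.min'_mem _ _)

/-- Proportional surplus transfer: when candidate `c` is elected with vote total
`s ≥ q`, every ballot currently counting for `c` is rescaled by `(s - q)/s`, so
that exactly the surplus `s - q` is passed on to the next remaining candidates
on those ballots. -/
def transferSurplus (ballots : List (WBallot C)) (rem : Finset C) (c : C) (q : ℚ) :
    List (WBallot C) :=
  let s := wscore ballots rem c
  ballots.map (fun b => if wtop rem b = some c then (b.1, b.2 * ((s - q) / s)) else b)

/-- One run of STV with quota `q` and `S` seats: in each round, if some remaining
candidate reaches quota, the one with the largest vote total is elected and their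
surplus is transferred proportionally; otherwise the candidate with the fewest
votes is eliminated and their ballots transfer at full value.  The process stops
when `S` candidates are elected, or when the remaining candidates suffice only to
fill the open seats (in which case they are all seated). -/
def stvAux (S : ℕ) (q : ℚ) (ballots : List (WBallot C)) (rem elected : Finset C) :
    Finset C :=
  if h1 : S ≤ elected.card then elected
  else if h2 : rem.card + elected.card ≤ S then elected ∪ rem
  else
    have h : rem.Nonempty := Finset.card_pos.mp (by omega)
    if (rem.filter (fun c => q ≤ wscore ballots rem c)).Nonempty then
      let c := argmaxScore ballots rem h
      stvAux S q (transferSurplus ballots rem c q) (rem.erase c) (insert c elected)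
    else
      stvAux S q ballots (rem.erase (argminScore ballots rem h)) elected
termination_by rem.card
decreasing_by
  · exact Finset.card_erase_lt_of_mem (argmaxScore_mem _ _ _)
  · exact Finset.card_erase_lt_of_mem (argminScore_mem _ _ _)

/-- The STV winner set for a profile of ballots (each with weight 1) with `S`
seats and Droop quota `⌊V/(S+1)⌋ + 1`. -/
def stvWinners [Fintype C] (S : ℕ) (P : List (List C)) : Finset C :=
  stvAux S ((P.length / (S + 1) + 1 : ℕ) : ℚ) (P.map (fun r => (r, (1 : ℚ))))
    Finset.univ ∅

end STV

/-- Candidates `C₁, C₂, C₃, C₄` are `0, 1, 2, 3 : Fin 4`.  The original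
1000-voter profile. -/
def P12 : List (List (Fin 4)) :=
  List.replicate 334 [0, 2, 3, 1] ++ List.replicate 314 [1, 0, 2, 3] ++
  List.replicate 312 [2, 1, 0, 3] ++ List.replicate 40 [3, 0, 1, 2]

/-- The profile after adding 3 ballots of the form `C₂≻C₁≻C₄≻C₃`. -/
def P12' : List (List (Fin 4)) := P12 ++ List.replicate 3 [1, 0, 3, 2]

section STV

variable {C : Type*} [DecidableEq C]

theorem wscore_append (A B : List (WBallot C)) (rem : Finset C) (c : C) :
    wscore (A ++ B) rem c = wscore A rem c + wscore B rem c := by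
  simp [wscore]

theorem wscore_replicate (n : ℕ) (b : WBallot C) (rem : Finset C) (c : C) :
    wscore (List.replicate n b) rem c = if wtop rem b = some c then n * b.2 else 0 := by
  by_cases h : wtop rem b = some c <;> simp [wscore, h]

variable [LinearOrder C]

theorem argmaxScore_eq {ballots : List (WBallot C)} {rem : Finset C} (h : rem.Nonempty) {c : C}
    (hc : c ∈ rem) (hmax : ∀ d ∈ rem, d ≠ c → wscore ballots rem d < wscore ballots rem c) :
    argmaxScore ballots rem h = c := by
  by_contra hne
  have hmem := Finset.min'_mem (rem.filter
    (fun c => ∀ d ∈ rem, wscore ballots rem d ≤ wscore ballots rem c)) (by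
      obtain ⟨c, hc, hmax⟩ := rem.exists_max_image (wscore ballots rem) h
      exact ⟨c, Finset.mem_filter.mpr ⟨hc, hmax⟩⟩)
  exact absurd ((Finset.mem_filter.mp hmem).2 c hc)
    (not_le.mpr (hmax _ (argmaxScore_mem ballots rem h) hne))

theorem argminScore_eq {ballots : List (WBallot C)} {rem : Finset C} (h : rem.Nonempty) {c : C}
    (hc : c ∈ rem) (hmin : ∀ d ∈ rem, d ≠ c → wscore ballots rem c < wscore ballots rem d) :
    argminScore ballots rem h = c := by
  by_contra hne
  have hmem := Finset.min'_mem (rem.filter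
    (fun c => ∀ d ∈ rem, wscore ballots rem c ≤ wscore ballots rem d)) (by
      obtain ⟨c, hc, hmin⟩ := rem.exists_min_image (wscore ballots rem) h
      exact ⟨c, Finset.mem_filter.mpr ⟨hc, hmin⟩⟩)
  exact absurd ((Finset.mem_filter.mp hmem).2 c hc)
    (not_le.mpr (hmin _ (argminScore_mem ballots rem h) hne))

theorem stvAux_of_le_card {S : ℕ} {q : ℚ} {ballots : List (WBallot C)} {rem elected : Finset C}
    (h : S ≤ elected.card) : stvAux S q ballots rem elected = elected := by
  rw [stvAux, dif_pos h]

/-- A round in which the strict leader `c` reaches quota elects `c`. -/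
theorem stvAux_elect {S : ℕ} {q : ℚ} {ballots : List (WBallot C)} {rem elected : Finset C}
    (c : C) (h1 : elected.card < S) (h2 : S < rem.card + elected.card) (hc : c ∈ rem)
    (hq : q ≤ wscore ballots rem c)
    (hmax : ∀ d ∈ rem, d ≠ c → wscore ballots rem d < wscore ballots rem c) :
    stvAux S q ballots rem elected =
      stvAux S q (transferSurplus ballots rem c q) (rem.erase c) (insert c elected) := by
  rw [stvAux, dif_neg h1.not_ge, dif_neg h2.not_ge]
  dsimp only
  rw [if_pos ⟨c, Finset.mem_filter.mpr ⟨hc, hq⟩⟩, argmaxScore_eq _ hc hmax]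

/-- A round in which nobody reaches quota eliminates the strict trailer `c`. -/
theorem stvAux_eliminate {S : ℕ} {q : ℚ} {ballots : List (WBallot C)} {rem elected : Finset C}
    (c : C) (h1 : elected.card < S) (h2 : S < rem.card + elected.card) (hc : c ∈ rem)
    (hq : ∀ d ∈ rem, wscore ballots rem d < q)
    (hmin : ∀ d ∈ rem, d ≠ c → wscore ballots rem c < wscore ballots rem d) :
    stvAux S q ballots rem elected = stvAux S q ballots (rem.erase c) elected := by
  rw [stvAux, dif_neg h1.not_ge, dif_neg h2.not_ge]
  dsimp only
  rw [if_neg, argminScore_eq _ hc hmin]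
  rintro ⟨d, hd⟩
  exact (hq d (Finset.mem_filter.mp hd).1).not_ge (Finset.mem_filter.mp hd).2

end STV

/-- The five ballot types of `P12'`, with multiplicity `n` for the added type and weights `w₁`,
`w₄` for the types that start with `C₁` and `C₄`. -/
def weightedP12 (n : ℕ) (w₁ w₄ : ℚ) : List (WBallot (Fin 4)) :=
  List.replicate 334 ([0, 2, 3, 1], w₁) ++ List.replicate 314 ([1, 0, 2, 3], 1) ++
  List.replicate 312 ([2, 1, 0, 3], 1) ++ List.replicate 40 ([3, 0, 1, 2], w₄) ++
  List.replicate n ([1, 0, 3, 2], 1)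

theorem map_P12 : P12.map (fun r => (r, (1 : ℚ))) = weightedP12 0 1 1 := by
  simp only [P12, weightedP12, List.map_append, List.map_replicate, List.replicate_zero,
    List.append_nil]

theorem map_P12' : P12'.map (fun r => (r, (1 : ℚ))) = weightedP12 3 1 1 := by
  simp only [P12', P12, weightedP12, List.map_append, List.map_replicate]

theorem wscore_weightedP12 (n : ℕ) (w₁ w₄ : ℚ) (rem : Finset (Fin 4)) (c : Fin 4) :
    wscore (weightedP12 n w₁ w₄) rem c =
      (if [0, 2, 3, 1].find? (· ∈ rem) = some c then 334 * w₁ else 0) +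
      (if [1, 0, 2, 3].find? (· ∈ rem) = some c then 314 else 0) +
      (if [2, 1, 0, 3].find? (· ∈ rem) = some c then 312 else 0) +
      (if [3, 0, 1, 2].find? (· ∈ rem) = some c then 40 * w₄ else 0) +
      (if [1, 0, 3, 2].find? (· ∈ rem) = some c then (n : ℚ) else 0) := by
  simp only [weightedP12, wscore_append, wscore_replicate, wtop, mul_one, Nat.cast_ofNat]
  congr!

theorem stvWinners_P12 : stvWinners 2 P12 = {0, 1} := by
  have hlen : P12.length = 1000 := by simp [P12, -List.reduceReplicate]
  rw [stvWinners, hlen, map_P12]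
  have ht : transferSurplus (weightedP12 0 1 1) Finset.univ 0 334 = weightedP12 0 0 1 := by
    have hs : wscore (weightedP12 0 1 1) Finset.univ 0 = 334 := by
      rw [wscore_weightedP12]; simp
    rw [transferSurplus, hs]
    simp [weightedP12, wtop, -List.reduceReplicate]
  have e1 : (Finset.univ : Finset (Fin 4)).erase 0 = {1, 2, 3} := by decide
  have e2 : ({1, 2, 3} : Finset (Fin 4)).erase 3 = {1, 2} := by decide
  norm_num only
  rw [stvAux_elect 0 (by decide) (by decide) (by decide), ht, e1,
    stvAux_eliminate 3 (by decide) (by decide) (by decide), e2,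
    stvAux_elect 1 (by decide) (by decide) (by decide), stvAux_of_le_card (by decide)]
  · decide
  all_goals simp [wscore_weightedP12, Fin.forall_fin_succ]
  all_goals norm_num

theorem stvWinners_P12' : stvWinners 2 P12' = {0, 2} := by
  have hlen : P12'.length = 1003 := by simp [P12', P12, -List.reduceReplicate]
  rw [stvWinners, hlen, map_P12']
  have ht : transferSurplus (weightedP12 3 1 1) {0, 1, 2} 0 335 =
      weightedP12 3 (39 / 374) (39 / 374) := by
    have hs : wscore (weightedP12 3 1 1) {0, 1, 2} 0 = 374 := by
      rw [wscore_weightedP12]; simp; norm_num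
    rw [transferSurplus, hs]
    simp [weightedP12, wtop, -List.reduceReplicate]
    norm_num
  have e1 : (Finset.univ : Finset (Fin 4)).erase 3 = {0, 1, 2} := by decide
  have e2 : ({0, 1, 2} : Finset (Fin 4)).erase 0 = {1, 2} := by decide
  norm_num only
  rw [stvAux_eliminate 3 (by decide) (by decide) (by decide), e1,
    stvAux_elect 0 (by decide) (by decide) (by decide), ht, e2,
    stvAux_elect 2 (by decide) (by decide) (by decide), stvAux_of_le_card (by decide)]
  · decide
  all_goals simp [wscore_weightedP12, Fin.forall_fin_succ]
  all_goals norm_num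

/-- Simultaneous paradoxes of positive and negative involvement in 2-seat STV:
adding 3 ballots `C₂≻C₁≻C₄≻C₃` raises the quota to `⌊1003/3⌋ + 1 = 335`, so `C₁`
(334 votes) no longer reaches quota in round 1; instead `C₄` (40 votes) is
eliminated, its 40 votes transferring to `C₁`, who is elected with `374 ≥ 335`
votes; `C₁`'s surplus of 39 transfers proportionally, giving `C₃` an extra
`39·(334/374) ≈ 34.8`; in the final round `C₃` (`≈ 346.83` votes) has more votes
than `C₂` (`≈ 321.17` votes), so `C₃` wins the second seat.  The winner set
changes from `{C₁, C₂}` to `{C₁, C₃}`: the added ballots rank `C₂` first yet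
`C₂` loses, and rank `C₃` last yet `C₃` wins. -/
theorem stv_double_involvement_P12 :
    stvWinners 2 P12 = {0, 1} ∧
    P12'.length = 1003 ∧ (1003 / 3 + 1 : ℕ) = 335 ∧
    wscore (P12'.map (fun r => (r, (1 : ℚ)))) Finset.univ 0 = 334 ∧ (334 : ℚ) < 335 ∧
    wscore (P12'.map (fun r => (r, (1 : ℚ)))) Finset.univ 3 = 40 ∧
    (334 + 40 : ℚ) = 374 ∧ (335 : ℚ) ≤ 374 ∧ (374 : ℚ) - 335 = 39 ∧
    (314 + 3 + 39 * (40 / 374) : ℚ) < 312 + 39 * (334 / 374) ∧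
    (335 : ℚ) ≤ 312 + 39 * (334 / 374) ∧
    stvWinners 2 P12' = {0, 2} := by
  refine ⟨stvWinners_P12, by simp [P12', P12, -List.reduceReplicate], by norm_num, ?_, by norm_num, ?_, by norm_num,
    by norm_num, by norm_num, by norm_num, by norm_num, stvWinners_P12'⟩
  all_goals
    rw [map_P12', wscore_weightedP12]
    simp
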